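/- Let ℱ be an 𝒩-saturated family of subsets of [n] and let M ∈ ℱ \ {∅, [n]} be such that every element of the component of ℱ containing M is comparable to M. Then the number of indices i ∈ [n] such that i ∉ M, M ∪ {i} ∉ ℱ, and three members of ℱ form with M ∪ {i} an induced copy of 𝒩 in which M ∪ {i} is a maximal element, is at most |ℱ| − 2. -/

import Mathlib

variable {n : ℕ}

/-- Two subsets of `[n]` are incomparable if neither contains the other. -/
def Incomp (X Y : Finset (Fin n)) : Prop := ¬ X ⊆ Y ∧ ¬ Y ⊆ X

/-- `A, B, C, D` form an induced copy of the poset `𝒩`, with maximal elements `A, B`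
and minimal elements `C, D`: `C ⊂ A`, `D ⊂ A`, `D ⊂ B`, and the pairs `{A,B}`, `{C,B}`,
`{C,D}` are incomparable.  Here `A` is the maximal element comparable to both minimal
elements and `D` is the minimal element comparable to both maximal elements. -/
def IsNCopy (A B C D : Finset (Fin n)) : Prop :=
  C ⊂ A ∧ D ⊂ A ∧ D ⊂ B ∧ Incomp A B ∧ Incomp C B ∧ Incomp C D

/-- A family contains an induced copy of `𝒩` if four of its members form such a copy. -/
def ContainsN (F : Finset (Finset (Fin n))) : Prop :=
  ∃ A B C D, A ∈ F ∧ B ∈ F ∧ C ∈ F ∧ D ∈ F ∧ IsNCopy A B C D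

/-- `F` is `𝒩`-saturated: it contains no induced copy of `𝒩`, but adding any missing
subset of `[n]` creates one. -/
def NSaturated (F : Finset (Finset (Fin n))) : Prop :=
  ¬ ContainsN F ∧ ∀ S : Finset (Fin n), S ∉ F → ContainsN (insert S F)

/-- The comparability graph on `F \ {∅, [n]}`: two distinct members of `F`, both different
from `∅` and `[n]`, are adjacent whenever one is a subset of the other.  This graph has
the same connected components as the Hasse diagram of `F \ {∅, [n]}`. -/
def compGraph (F : Finset (Finset (Fin n))) : SimpleGraph (Finset (Fin n)) where
  Adj X Y := X ≠ Y ∧ X ∈ F ∧ Y ∈ F ∧ X ≠ ∅ ∧ X ≠ Finset.univ ∧ Y ≠ ∅ ∧ Y ≠ Finset.univ ∧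
    (X ⊆ Y ∨ Y ⊆ X)
  symm := by
    constructor
    rintro X Y ⟨h1, h2, h3, h4, h5, h6, h7, h8⟩
    exact ⟨h1.symm, h3, h2, h6, h7, h4, h5, h8.symm⟩
  loopless := ⟨fun X h => h.1 rfl⟩

/-- `G` is a component of `F`: the set of vertices reachable in the comparability graph
from some member of `F \ {∅, [n]}`. -/
def IsComponent (F : Finset (Finset (Fin n))) (G : Set (Finset (Fin n))) : Prop :=
  ∃ X₀, X₀ ∈ F ∧ X₀ ≠ ∅ ∧ X₀ ≠ Finset.univ ∧ G = {Y | (compGraph F).Reachable X₀ Y}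

/-- A maximal element of a component: a member not strictly contained in any member. -/
def IsMaxIn (G : Set (Finset (Fin n))) (T : Finset (Fin n)) : Prop :=
  T ∈ G ∧ ∀ Y ∈ G, ¬ T ⊂ Y

/-- A minimal element of a component: a member not strictly containing any member. -/
def IsMinIn (G : Set (Finset (Fin n))) (S : Finset (Fin n)) : Prop :=
  S ∈ G ∧ ∀ Y ∈ G, ¬ Y ⊂ S

lemma Incomp.symm {X Y : Finset (Fin n)} (h : Incomp X Y) : Incomp Y X := ⟨h.2, h.1⟩

lemma Incomp.ne_empty {X Y : Finset (Fin n)} (h : Incomp X Y) : X ≠ ∅ := by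
  rintro rfl
  exact h.1 (Finset.empty_subset _)

lemma Incomp.ne_univ {X Y : Finset (Fin n)} (h : Incomp X Y) : X ≠ Finset.univ := by
  rintro rfl
  exact h.2 (Finset.subset_univ _)

/-- A set incomparable to no set belongs to every `𝒩`-saturated family. -/
lemma NSaturated.mem_of_forall_not_incomp {F : Finset (Finset (Fin n))} (hF : NSaturated F)
    {S : Finset (Fin n)} (hS : ∀ X, ¬ Incomp S X) : S ∈ F := by
  by_contra hSF
  obtain ⟨A, B, C, D, hA, hB, hC, hD, h⟩ := hF.2 S hSF
  have mem {X Y : Finset (Fin n)} (hX : X ∈ insert S F) (hXY : Incomp X Y) : X ∈ F :=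
    Finset.mem_of_mem_insert_of_ne hX fun hXS => hS Y (hXS ▸ hXY)
  obtain ⟨-, -, -, hAB, hCB, hCD⟩ := id h
  exact hF.1 ⟨A, B, C, D, mem hA hAB, mem hB hAB.symm, mem hC hCB, mem hD hCD.symm, h⟩

lemma NSaturated.empty_mem {F : Finset (Finset (Fin n))} (hF : NSaturated F) : ∅ ∈ F :=
  hF.mem_of_forall_not_incomp fun _ h => h.ne_empty rfl

lemma NSaturated.univ_mem {F : Finset (Finset (Fin n))} (hF : NSaturated F) :
    Finset.univ ∈ F :=
  hF.mem_of_forall_not_incomp fun _ h => h.ne_univ rfl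

lemma compGraph_reachable_of_comparable {F : Finset (Finset (Fin n))} {X Y : Finset (Fin n)}
    (hX : X ∈ F) (hY : Y ∈ F) (hX0 : X ≠ ∅) (hX1 : X ≠ Finset.univ) (hY0 : Y ≠ ∅)
    (hY1 : Y ≠ Finset.univ) (h : X ⊆ Y ∨ Y ⊆ X) : (compGraph F).Reachable X Y := by
  by_cases hXY : X = Y
  · exact hXY ▸ SimpleGraph.Reachable.refl _
  · exact SimpleGraph.Adj.reachable ⟨hXY, hX, hY, hX0, hX1, hY0, hY1, h⟩

/-- If `M ∪ {i}` is a maximal element of a copy of `𝒩` whose other members lie in `F`, then one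
of the minimal elements of that copy contains `i`. -/
lemma exists_ssubset_insert_of_isNCopy {F : Finset (Finset (Fin n))} {M : Finset (Fin n)}
    (hM : M ∈ F) (hM0 : M ≠ ∅) (hM1 : M ≠ Finset.univ)
    (hcomp : ∀ X, (compGraph F).Reachable M X → X ⊆ M ∨ M ⊆ X) {i : Fin n}
    {P Q R : Finset (Fin n)} (hP : P ∈ F) (hQ : Q ∈ F) (hR : R ∈ F)
    (h : IsNCopy (insert i M) P Q R ∨ IsNCopy P (insert i M) Q R) :
    ∃ E ∈ F, i ∈ E ∧ E ⊂ insert i M := by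
  by_contra! hE
  have below {X : Finset (Fin n)} (hX : X ∈ F) (hXS : X ⊂ insert i M) : X ⊆ M :=
    (Finset.subset_insert_iff_of_notMem fun hi => hE X hX hi hXS).1 hXS.1
  have hMS : M ⊆ insert i M := Finset.subset_insert i M
  rcases h with ⟨hQS, hRS, hRP, hSP, hQP, hQR⟩ | ⟨hQP, hRP, hRS, hPS, hQS, hQR⟩
  · have hRM := below hR hRS
    have hMR := compGraph_reachable_of_comparable hM hR hM0 hM1 hQR.symm.ne_empty
      hQR.symm.ne_univ (.inr hRM)
    have hRP' := compGraph_reachable_of_comparable hR hP hQR.symm.ne_empty hQR.symm.ne_univ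
      hSP.symm.ne_empty hSP.symm.ne_univ (.inl hRP.1)
    rcases hcomp P (hMR.trans hRP') with hPM | hMP
    · exact hSP.2 (hPM.trans hMS)
    · exact hQP.1 ((below hQ hQS).trans hMP)
  · have hRM := below hR hRS
    have hMR := compGraph_reachable_of_comparable hM hR hM0 hM1 hQR.symm.ne_empty
      hQR.symm.ne_univ (.inr hRM)
    have hRP' := compGraph_reachable_of_comparable hR hP hQR.symm.ne_empty hQR.symm.ne_univ
      hPS.ne_empty hPS.ne_univ (.inl hRP.1)
    have hPQ := compGraph_reachable_of_comparable hP hQ hPS.ne_empty hPS.ne_univ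
      hQR.ne_empty hQR.ne_univ (.inr hQP.1)
    rcases hcomp Q ((hMR.trans hRP').trans hPQ) with hQM | hMQ
    · exact hQS.1 (hQM.trans hMS)
    · exact hQR.2 (hRM.trans hMQ)

/-- let `M ∈ F \ {∅, [n]}` be comparable to every element of the component
of `F` containing it.  Then the number of indices `i` with `i ∉ M`, `M ∪ {i} ∉ F`, and
`M ∪ {i}` a maximal element of some induced copy of `𝒩` formed with three members of
`F`, is at most `|F| − 2`. -/
theorem stmt16 (n : ℕ) (F : Finset (Finset (Fin n))) (hF : NSaturated F)
    (M : Finset (Fin n)) (hM : M ∈ F) (hM0 : M ≠ ∅) (hM1 : M ≠ Finset.univ)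
    (hcomp : ∀ X, (compGraph F).Reachable M X → X ⊆ M ∨ M ⊆ X) :
    {i : Fin n | i ∉ M ∧ insert i M ∉ F ∧
      ∃ P Q R, P ∈ F ∧ Q ∈ F ∧ R ∈ F ∧
        (IsNCopy (insert i M) P Q R ∨ IsNCopy P (insert i M) Q R)}.ncard
      ≤ F.card - 2 := by
  have key (i : Fin n) : ∃ E, (i ∉ M ∧ insert i M ∉ F ∧
      ∃ P Q R, P ∈ F ∧ Q ∈ F ∧ R ∈ F ∧
        (IsNCopy (insert i M) P Q R ∨ IsNCopy P (insert i M) Q R)) →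
      E ∈ F ∧ i ∈ E ∧ E ⊂ insert i M := by
    by_cases h : ∃ E ∈ F, i ∈ E ∧ E ⊂ insert i M
    · obtain ⟨E, hE⟩ := h
      exact ⟨E, fun _ => hE⟩
    · exact ⟨∅, fun ⟨_, _, P, Q, R, hP, hQ, hR, hN⟩ =>
        absurd (exists_ssubset_insert_of_isNCopy hM hM0 hM1 hcomp hP hQ hR hN) h⟩
  choose f hf using key
  have hne : (Finset.univ : Finset (Fin n)) ≠ ∅ := fun h =>
    hM0 (Finset.subset_empty.1 (h ▸ Finset.subset_univ M))
  have hcard : ((F.erase ∅).erase Finset.univ).card = F.card - 2 := by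
    rw [Finset.card_erase_of_mem (Finset.mem_erase.2 ⟨hne, hF.univ_mem⟩),
      Finset.card_erase_of_mem hF.empty_mem, Nat.sub_sub]
  rw [← hcard, ← Set.ncard_coe_finset]
  refine Set.ncard_le_ncard_of_injOn f ?_ ?_ (Finset.finite_toSet _)
  · intro i hi
    obtain ⟨hEF, hiE, hES⟩ := hf i hi
    refine Finset.mem_coe.2 (Finset.mem_erase.2 ⟨?_, Finset.mem_erase.2 ⟨?_, hEF⟩⟩)
    · exact fun h => hES.2 (h ▸ Finset.subset_univ _)
    · exact Finset.ne_empty_of_mem hiE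
  · intro i hi j hj hij
    have hiE : i ∈ f j := hij ▸ (hf i hi).2.1
    exact (Finset.mem_insert.1 ((hf j hj).2.2.1 hiE)).resolve_right hi.1
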